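/- Let A ∈ ℝ^{n×n} be semi-Hurwitz and B ∈ ℝ^{n×m} satisfy ran(B) ⊆ ran(A). Let w : [0,∞) → ℝ^m be measurable and essentially bounded on bounded intervals, let x_0 ∈ ℝ^n, and let x : [0,∞) → ℝ^n be the solution of the linear system ẋ(t) = A x(t) + B w(t) with x(0) = x_0. Let x* be the oblique projection of x_0 onto ker(A) along ran(A). Then there exist constants c_1, c_2, c_3 > 0 (independent of x_0 and w) such that for all t ≥ 0: ‖x(t) − x*‖ ≤ c_1 e^{−c_2 t} ‖x_0 − x*‖ + c_3 · ess sup_{s∈[0,t]} ‖w(s)‖. -/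

import Mathlib

open Matrix Polynomial MeasureTheory

/-- The characteristic polynomial of a real matrix, viewed over `ℂ`. Its roots are the
(complex) eigenvalues of the matrix. -/
noncomputable def charpolyC {ι : Type*} [Fintype ι] [DecidableEq ι]
    (A : Matrix ι ι ℝ) : Polynomial ℂ :=
  (A.charpoly).map (algebraMap ℝ ℂ)

/-- A real square matrix is *semi-Hurwitz* if every (complex) eigenvalue either has negative
real part, or equals `0` and `0` is non-defective. -/
def IsSemiHurwitz {ι : Type*} [Fintype ι] [DecidableEq ι] (A : Matrix ι ι ℝ) : Prop :=
  ∀ μ : ℂ, (charpolyC A).IsRoot μ →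
    μ.re < 0 ∨ (μ = 0 ∧
      Module.finrank ℝ (LinearMap.ker A.mulVecLin) = (charpolyC A).rootMultiplicity 0)


lemma ac_integral {f : ℝ → ℂ} {T K : ℝ} (hT : 0 ≤ T) (hf : IntervalIntegrable f volume 0 T)
    (hK : ∀ᵐ s, s ∈ Set.Icc (0:ℝ) T → ‖f s‖ ≤ K) :
    AbsolutelyContinuousOnInterval (fun t => ∫ s in (0:ℝ)..t, f s) 0 T := by
  apply LipschitzOnWith.absolutelyContinuousOnInterval (K := K.toNNReal)
  rw [Set.uIcc_of_le hT]
  apply LipschitzOnWith.of_dist_le_mul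
  intro x hx y hy
  have i1 : ∀ x ∈ Set.Icc (0:ℝ) T, IntervalIntegrable f volume 0 x := by
    intro x hx
    apply hf.mono_set
    rw [Set.uIcc_of_le hT, Set.uIcc_of_le hx.1]
    exact Set.Icc_subset_Icc le_rfl hx.2
  rw [dist_eq_norm, intervalIntegral.integral_interval_sub_left (i1 x hx) (i1 y hy), Real.dist_eq]
  apply intervalIntegral.norm_integral_le_of_norm_le_const_ae
  filter_upwards [hK] with s hs hs2
  refine (hs ?_).trans (Real.le_coe_toNNReal K)
  have := Set.uIoc_subset_uIcc hs2
  exact (Set.uIcc_subset_Icc hy hx) this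

lemma voc (μ : ℂ) (z u : ℝ → ℂ) (z0 : ℂ) {T K : ℝ} (hT : 0 ≤ T)
    (hz : ∀ t ∈ Set.Icc (0:ℝ) T, z t = z0 + ∫ s in (0:ℝ)..t, (μ * z s + u s))
    (hzc : ContinuousOn z (Set.Icc 0 T)) (hu : IntervalIntegrable u volume 0 T)
    (hub : ∀ᵐ s, s ∈ Set.Icc (0:ℝ) T → ‖u s‖ ≤ K) :
    ∀ t ∈ Set.Icc (0:ℝ) T,
      Complex.exp (-μ * t) * z t = z0 + ∫ s in (0:ℝ)..t, Complex.exp (-μ * s) * u s := by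
  have hU := Set.uIcc_of_le hT
  obtain ⟨Kz, hKz⟩ := isCompact_Icc.exists_bound_of_continuousOn hzc
  have hE : Continuous (fun s : ℝ => Complex.exp (-μ * s)) := by fun_prop
  obtain ⟨Ke, hKe⟩ := (isCompact_Icc (a := (0:ℝ)) (b := T)).exists_bound_of_continuousOn
    hE.continuousOn
  have hf : IntervalIntegrable (fun s => μ * z s + u s) volume 0 T := by
    refine IntervalIntegrable.add (IntervalIntegrable.const_mul ?_ μ) hu
    exact ContinuousOn.intervalIntegrable (by rwa [hU])
  have hg : IntervalIntegrable (fun s : ℝ => Complex.exp (-μ * s) * u s) volume 0 T :=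
    hu.continuousOn_mul hE.continuousOn
  have ac1 := ac_integral (K := ‖μ‖ * Kz + K) hT hf (by
    filter_upwards [hub] with s hs hsT
    refine (norm_add_le _ _).trans ?_
    rw [norm_mul]
    gcongr
    · exact hKz s hsT
    · exact hs hsT)
  have ac2 := ac_integral (K := Ke * K) hT hg (by
    filter_upwards [hub] with s hs hsT
    rw [norm_mul]
    have := hKe s hsT
    have h2 := hs hsT
    gcongr
    exact (norm_nonneg _).trans this)
  have ac0 : AbsolutelyContinuousOnInterval (fun _ : ℝ => z0) 0 T :=
    ContDiffOn.absolutelyContinuousOnInterval contDiffOn_const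
  have acE : AbsolutelyContinuousOnInterval (fun s : ℝ => Complex.exp (-μ * s)) 0 T := by
    apply ContDiffOn.absolutelyContinuousOnInterval
    apply ContDiff.contDiffOn
    have : ContDiff ℝ 1 (fun s : ℝ => (s:ℂ)) := Complex.ofRealCLM.contDiff
    fun_prop
  have acH := (acE.fun_smul (ac0.add ac1)).sub ac2
  obtain ⟨C, hC⟩ := acH.const_of_ae_hasDerivAt_zero (by
    have ne : ∀ᵐ s : ℝ, s ≠ 0 ∧ s ≠ T := by
      have h1 : ∀ᵐ s : ℝ, s ≠ 0 := Measure.ae_ne volume 0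
      have h2 : ∀ᵐ s : ℝ, s ≠ T := Measure.ae_ne volume T
      filter_upwards [h1, h2] with s a b using ⟨a, b⟩
    filter_upwards [hf.ae_hasDerivAt_integral, hg.ae_hasDerivAt_integral] with s h1 h2 hs
    have h1 := h1 hs 0 (by simp)
    have h2 := h2 hs 0 (by simp)
    have hd : HasDerivAt (fun s : ℝ => Complex.exp (-μ * s)) (Complex.exp (-μ * s) * (-μ)) s := by
      have : HasDerivAt (fun s : ℝ => -μ * (s:ℂ)) (-μ) s := by
        simpa using (Complex.ofRealCLM.hasDerivAt (x := s)).const_mul (-μ)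
      exact this.cexp
    have h3 := (hd.mul ((hasDerivAt_const s z0).add h1)).sub h2
    have h4 := hz s (by rwa [hU] at hs)
    refine h3.congr_deriv ?_
    simp only [Pi.add_apply]
    rw [← h4]; ring)
  intro t ht
  have e1 := hC t (by rwa [hU])
  have e2 := hC 0 (by simp)
  simp only [Pi.sub_apply, Pi.add_apply, smul_eq_mul] at e1 e2
  rw [← hz t ht] at e1
  simp at e2
  rw [← e2] at e1
  linear_combination e1

lemma scalar_est (μ : ℂ) (c d : ℝ) (hd : d = -μ.re) (hc : 0 < c) (hcd : c < d)
    (z u : ℝ → ℂ) (z0 : ℂ) {T a b : ℝ} (hT : 0 ≤ T) (ha : 0 ≤ a) (hb : 0 ≤ b)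
    (hz : ∀ t ∈ Set.Icc (0:ℝ) T, z t = z0 + ∫ s in (0:ℝ)..t, (μ * z s + u s))
    (hzc : ContinuousOn z (Set.Icc 0 T)) (hu : IntervalIntegrable u volume 0 T)
    (hub : ∀ᵐ s, s ∈ Set.Icc (0:ℝ) T → ‖u s‖ ≤ a * Real.exp (-c * s) + b) :
    ∀ t ∈ Set.Icc (0:ℝ) T, ‖z t‖ ≤ Real.exp (-c * t) * ‖z0‖ +
      a / (d - c) * Real.exp (-c * t) + b / d := by
  intro t ht
  have hdpos : 0 < d := hc.trans hcd
  have hdc : 0 < d - c := sub_pos.2 hcd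
  have key := voc μ z u z0 (K := a + b) hT hz hzc hu (by
    filter_upwards [hub] with s hs hsT
    refine (hs hsT).trans ?_
    have : Real.exp (-c * s) ≤ 1 := Real.exp_le_one_iff.2 (by nlinarith [hsT.1])
    nlinarith) t ht
  have hne : ∀ s : ℝ, ‖Complex.exp (-μ * s)‖ = Real.exp (d * s) := by
    intro s; rw [Complex.norm_exp]; simp [hd]
  have hI : ‖∫ s in (0:ℝ)..t, Complex.exp (-μ * s) * u s‖ ≤
      ∫ s in (0:ℝ)..t, (a * Real.exp ((d - c) * s) + b * Real.exp (d * s)) := by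
    apply intervalIntegral.norm_integral_le_of_norm_le ht.1
    · filter_upwards [hub] with s hs hst
      have := hs ⟨hst.1.le, hst.2.trans ht.2⟩
      rw [norm_mul, hne]
      calc Real.exp (d * s) * ‖u s‖ ≤ Real.exp (d * s) * (a * Real.exp (-c * s) + b) := by gcongr
        _ = _ := by
          have : Real.exp ((d - c) * s) = Real.exp (d * s) * Real.exp (-c * s) := by
            rw [← Real.exp_add]; ring_nf
          rw [this]; ring
    · apply Continuous.intervalIntegrable; fun_prop
  have hexp : ∀ k : ℝ, 0 < k → ∫ s in (0:ℝ)..t, Real.exp (k * s) = (Real.exp (k * t) - 1) / k := by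
    intro k hk
    rw [intervalIntegral.integral_comp_mul_left (fun s => Real.exp s) hk.ne']
    simp [integral_exp]; field_simp
  rw [intervalIntegral.integral_add (by apply Continuous.intervalIntegrable; fun_prop)
    (by apply Continuous.intervalIntegrable; fun_prop), intervalIntegral.integral_const_mul,
    intervalIntegral.integral_const_mul, hexp _ hdc, hexp _ hdpos] at hI
  have hn : Real.exp (d * t) * ‖z t‖ ≤ ‖z0‖ + (a * ((Real.exp ((d - c) * t) - 1) / (d - c)) +
      b * ((Real.exp (d * t) - 1) / d)) := by
    rw [← hne, ← norm_mul, key]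
    exact (norm_add_le _ _).trans (by rw [hne]; gcongr)
  have hpos := Real.exp_pos (d * t)
  refine le_of_mul_le_mul_left (hn.trans ?_) hpos
  have e1 : Real.exp (d * t) * Real.exp (-c * t) = Real.exp ((d - c) * t) := by
    rw [← Real.exp_add]; ring_nf
  have e2 : 1 ≤ Real.exp ((d - c) * t) := Real.one_le_exp (by nlinarith [ht.1])
  have : Real.exp (d * t) * (Real.exp (-c * t) * ‖z0‖ + a / (d - c) * Real.exp (-c * t) + b / d)
    = Real.exp ((d-c)*t) * ‖z0‖ + a / (d - c) * Real.exp ((d - c) * t) + b / d * Real.exp (d*t) := by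
    rw [← e1]; ring
  rw [this]
  have p1 : 0 ≤ a / (d - c) := by positivity
  have p2 : 0 ≤ b / d := by positivity
  have p3 := norm_nonneg z0
  have q1 : a * ((Real.exp ((d - c) * t) - 1) / (d - c)) = a / (d-c) * Real.exp ((d - c) * t) - a / (d-c) := by
    ring
  have q2 : b * ((Real.exp (d * t) - 1) / d) = b / d * Real.exp (d * t) - b / d := by
    ring
  rw [q1, q2]
  nlinarith

lemma nondef {n : ℕ} (A : Matrix (Fin n) (Fin n) ℝ)
    (h : Module.finrank ℝ (LinearMap.ker A.mulVecLin) = (charpolyC A).rootMultiplicity 0)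
    (l : Fin n → ℂ) (k : ℕ) (hk : ((Aᵀ.map (algebraMap ℝ ℂ)) ^ k) *ᵥ l = 0) :
    (Aᵀ.map (algebraMap ℝ ℂ)) *ᵥ l = 0 := by
  have hr : (charpolyC A).rootMultiplicity 0 = Aᵀ.charpoly.rootMultiplicity 0 := by
    rw [Matrix.charpoly_transpose, charpolyC,
      Polynomial.eq_rootMultiplicity_map (algebraMap ℝ ℂ).injective 0, map_zero]
  have hker : Module.finrank ℝ (LinearMap.ker Aᵀ.mulVecLin)
      = Module.finrank ℝ (LinearMap.ker A.mulVecLin) := by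
    have h1 := LinearMap.finrank_range_add_finrank_ker A.mulVecLin
    have h2 := LinearMap.finrank_range_add_finrank_ker Aᵀ.mulVecLin
    have h3 := Matrix.rank_transpose A
    unfold Matrix.rank at h3
    omega
  have hgen := LinearMap.finrank_maxGenEigenspace_eq (Aᵀ.mulVecLin) (0:ℝ)
  have hcp : (Aᵀ.mulVecLin).charpoly = Aᵀ.charpoly := Matrix.charpoly_mulVecLin Aᵀ
  rw [hcp, ← hr, ← h, ← hker] at hgen
  have hle : LinearMap.ker Aᵀ.mulVecLin ≤ Module.End.maxGenEigenspace (Aᵀ.mulVecLin) (0:ℝ) := by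
    intro v hv
    rw [Module.End.mem_maxGenEigenspace]
    exact ⟨1, by simpa using hv⟩
  have heq := Submodule.eq_of_le_of_finrank_eq hle hgen.symm
  have real : ∀ v : Fin n → ℝ, (Aᵀ ^ k) *ᵥ v = 0 → Aᵀ *ᵥ v = 0 := by
    intro v hv
    have : v ∈ LinearMap.ker Aᵀ.mulVecLin := by
      rw [heq, Module.End.mem_maxGenEigenspace]
      refine ⟨k, ?_⟩
      have : Aᵀ.mulVecLin ^ k = (Aᵀ ^ k).mulVecLin := by
        simp only [← Matrix.toLin'_apply', Matrix.toLin'_pow]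
      rw [zero_smul, sub_zero, this]
      exact hv
    exact this
  have hpow : (Aᵀ.map (algebraMap ℝ ℂ)) ^ k = (Aᵀ ^ k).map (algebraMap ℝ ℂ) := by
    simpa using (map_pow (algebraMap ℝ ℂ).mapMatrix Aᵀ k).symm
  have hre : ∀ M : Matrix (Fin n) (Fin n) ℝ, ∀ i,
      ((M.map (algebraMap ℝ ℂ)) *ᵥ l) i =
        (((M *ᵥ fun j => (l j).re) i : ℝ) : ℂ) + (((M *ᵥ fun j => (l j).im) i : ℝ) : ℂ) * Complex.I := by
    intro M i
    apply Complex.ext <;> simp [Matrix.mulVec, dotProduct]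
  rw [hpow] at hk
  have hz : ∀ i, (((Aᵀ ^ k) *ᵥ fun j => (l j).re) i) = 0 ∧ ((Aᵀ ^ k) *ᵥ fun j => (l j).im) i = 0 := by
    intro i
    have := congrFun hk i
    rw [hre] at this
    have a := congrArg Complex.re this
    have b := congrArg Complex.im this
    simp at a b
    exact ⟨a, b⟩
  have r1 := real _ (funext fun i => (hz i).1)
  have r2 := real _ (funext fun i => (hz i).2)
  funext i
  rw [hre, r1, r2]; simp

/-- The functional associated with a complex row vector. -/
noncomputable def PhiF {n : ℕ} (l : Fin n → ℂ) : (Fin n → ℝ) →L[ℝ] ℂ :=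
  ∑ i, (l i) • (Complex.ofRealCLM.comp (ContinuousLinearMap.proj (R := ℝ) (φ := fun _ => ℝ) i))

lemma PhiF_apply {n : ℕ} (l : Fin n → ℂ) (v : Fin n → ℝ) : PhiF l v = ∑ i, l i * (v i : ℂ) := by
  simp [PhiF]

lemma PhiF_add {n : ℕ} (l l' : Fin n → ℂ) (v : Fin n → ℝ) :
    PhiF (l + l') v = PhiF l v + PhiF l' v := by
  simp [PhiF_apply, add_mul, Finset.sum_add_distrib]

lemma PhiF_smul {n : ℕ} (a : ℂ) (l : Fin n → ℂ) (v : Fin n → ℝ) :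
    PhiF (a • l) v = a * PhiF l v := by
  simp [PhiF_apply, Finset.mul_sum, mul_assoc]

/-- The complexified transpose. -/
noncomputable def FF {n : ℕ} (A : Matrix (Fin n) (Fin n) ℝ) : Module.End ℂ (Fin n → ℂ) :=
  (Aᵀ.map (algebraMap ℝ ℂ)).mulVecLin

lemma PhiF_mulVec {n : ℕ} (A : Matrix (Fin n) (Fin n) ℝ) (l : Fin n → ℂ) (v : Fin n → ℝ) :
    PhiF l (A *ᵥ v) = PhiF (FF A l) v := by
  simp only [PhiF_apply, FF, Matrix.mulVecLin_apply, Matrix.mulVec, dotProduct, Matrix.map_apply,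
    Matrix.transpose_apply, Complex.ofReal_sum, Finset.mul_sum, Finset.sum_mul, Complex.ofReal_mul]
  rw [Finset.sum_comm]
  refine Finset.sum_congr rfl fun i _ => Finset.sum_congr rfl fun j _ => ?_
  simp; ring

/-- Solution data on `[0,T]`. -/
structure SolD {n m : ℕ} (A : Matrix (Fin n) (Fin n) ℝ) (B : Matrix (Fin n) (Fin m) ℝ)
    (y : ℝ → Fin n → ℝ) (w : ℝ → Fin m → ℝ) (T W : ℝ) : Prop where
  hT : 0 ≤ T
  hW : 0 ≤ W
  hyc : ContinuousOn y (Set.Icc 0 T)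
  hBw : IntervalIntegrable (fun s => B *ᵥ (w s)) volume 0 T
  hw : ∀ᵐ s, s ∈ Set.Icc (0:ℝ) T → ‖w s‖ ≤ W
  heq : ∀ t ∈ Set.Icc (0:ℝ) T, y t = y 0 + ∫ s in (0:ℝ)..t, (A *ᵥ (y s) + B *ᵥ (w s))
  hran : y 0 ∈ LinearMap.range A.mulVecLin

lemma SolD.proj {n m : ℕ} {A : Matrix (Fin n) (Fin n) ℝ} {B : Matrix (Fin n) (Fin m) ℝ}
    {y : ℝ → Fin n → ℝ} {w : ℝ → Fin m → ℝ} {T W : ℝ} (h : SolD A B y w T W) (l : Fin n → ℂ) :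
    ∀ t ∈ Set.Icc (0:ℝ) T, PhiF l (y t) = PhiF l (y 0) +
      ∫ s in (0:ℝ)..t, (PhiF (FF A l) (y s) + PhiF l (B *ᵥ (w s))) := by
  intro t ht
  have hsub : Set.uIcc 0 t ⊆ Set.uIcc 0 T := by
    rw [Set.uIcc_of_le h.hT, Set.uIcc_of_le ht.1]
    exact Set.Icc_subset_Icc le_rfl ht.2
  have hAc : ContinuousOn (fun s => A *ᵥ (y s)) (Set.Icc 0 T) :=
    (LinearMap.toContinuousLinearMap A.mulVecLin).continuous.comp_continuousOn h.hyc
  have hi : IntervalIntegrable (fun s => A *ᵥ (y s) + B *ᵥ (w s)) volume 0 t := by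
    refine IntervalIntegrable.mono_set (IntervalIntegrable.add ?_ h.hBw) hsub
    exact ContinuousOn.intervalIntegrable (by rwa [Set.uIcc_of_le h.hT])
  conv_lhs => rw [h.heq t ht, map_add, ← ContinuousLinearMap.intervalIntegral_comp_comm _ hi]
  simp only [map_add, PhiF_mulVec]

/-- The estimate for one functional. -/
def EstF {n m : ℕ} (A : Matrix (Fin n) (Fin n) ℝ) (B : Matrix (Fin n) (Fin m) ℝ) (c : ℝ)
    (l : Fin n → ℂ) : Prop :=
  ∃ C : ℝ, 0 ≤ C ∧ ∀ y w T W, SolD A B y w T W → ∀ t ∈ Set.Icc (0:ℝ) T,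
    ‖PhiF l (y t)‖ ≤ C * (Real.exp (-c * t) * ‖y 0‖ + W)

lemma EstF.add {n m : ℕ} {A : Matrix (Fin n) (Fin n) ℝ} {B : Matrix (Fin n) (Fin m) ℝ} {c : ℝ}
    {l l' : Fin n → ℂ} (h : EstF A B c l) (h' : EstF A B c l') : EstF A B c (l + l') := by
  obtain ⟨C, hC, h⟩ := h
  obtain ⟨C', hC', h'⟩ := h'
  refine ⟨C + C', by positivity, fun y w T W hs t ht => ?_⟩
  rw [PhiF_add, add_mul]
  exact (norm_add_le _ _).trans (add_le_add (h y w T W hs t ht) (h' y w T W hs t ht))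

lemma EstF.zero_of_ker {n m : ℕ} {A : Matrix (Fin n) (Fin n) ℝ} {B : Matrix (Fin n) (Fin m) ℝ}
    {c : ℝ} (hB : LinearMap.range B.mulVecLin ≤ LinearMap.range A.mulVecLin)
    {l : Fin n → ℂ} (h : FF A l = 0) : EstF A B c l := by
  have hz : ∀ v ∈ LinearMap.range A.mulVecLin, PhiF l v = 0 := by
    rintro _ ⟨u, rfl⟩
    rw [Matrix.mulVecLin_apply, PhiF_mulVec, h]
    simp [PhiF_apply]
  refine ⟨0, le_rfl, fun y w T W hs t ht => ?_⟩
  rw [hs.proj l t ht, hz _ hs.hran, h]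
  have : ∀ s, PhiF l (B *ᵥ w s) = 0 := fun s => hz _ (hB ⟨w s, rfl⟩)
  simp [this, PhiF_apply]

lemma EstF.step {n m : ℕ} {A : Matrix (Fin n) (Fin n) ℝ} {B : Matrix (Fin n) (Fin m) ℝ}
    {c : ℝ} (hc : 0 < c) {μ : ℂ} (hμ : c < -μ.re) {l : Fin n → ℂ}
    (h : EstF A B c (FF A l - μ • l)) : EstF A B c l := by
  obtain ⟨C, hC, h⟩ := h
  set d := -μ.re with hd
  have hdpos : 0 < d := hc.trans hμ
  have hdc : 0 < d - c := sub_pos.2 hμ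
  set BL := LinearMap.toContinuousLinearMap B.mulVecLin
  have hBL : ∀ v, BL v = B *ᵥ v := fun v => rfl
  set K := ‖PhiF l‖ * ‖BL‖ with hK
  have hKn : 0 ≤ K := by positivity
  refine ⟨‖PhiF l‖ + C / (d - c) + (C + K) / d, by positivity, fun y w T W hs t ht => ?_⟩
  have hW := hs.hW
  have hsplit : ∀ v, PhiF (FF A l) v = μ * PhiF l v + PhiF (FF A l - μ • l) v := by
    intro v
    rw [← PhiF_smul, ← PhiF_add]; congr 2; abel
  have hyc := hs.hyc
  have key := scalar_est μ c d hd hc hμ (fun s => PhiF l (y s))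
    (fun s => PhiF (FF A l - μ • l) (y s) + PhiF l (B *ᵥ w s)) (PhiF l (y 0))
    (a := C * ‖y 0‖) (b := (C + K) * W) hs.hT (by positivity) (by positivity)
    (by
      intro t ht
      rw [hs.proj l t ht]
      simp only [hsplit, add_assoc])
    ((PhiF l).continuous.comp_continuousOn hyc)
    (by
      refine IntervalIntegrable.add ?_ ?_
      · apply ContinuousOn.intervalIntegrable
        rw [Set.uIcc_of_le hs.hT]
        exact (PhiF _).continuous.comp_continuousOn hyc
      · have := hs.hBw
        rw [intervalIntegrable_iff] at this ⊢
        exact (PhiF l).integrable_comp this)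
    (by
      filter_upwards [hs.hw] with s hsw hsT
      have h1 := h y w T W hs s hsT
      have h2 : ‖PhiF l (B *ᵥ w s)‖ ≤ K * W := by
        rw [← hBL]
        calc _ ≤ ‖PhiF l‖ * ‖BL (w s)‖ := (PhiF l).le_opNorm _
          _ ≤ ‖PhiF l‖ * (‖BL‖ * W) := by
            gcongr
            exact (BL.le_opNorm _).trans (by gcongr; exact hsw hsT)
          _ = _ := by ring
      refine (norm_add_le _ _).trans ((add_le_add h1 h2).trans (le_of_eq ?_))
      ring) t ht
  refine key.trans ?_
  have hy0 := (PhiF l).le_opNorm (y 0)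
  have e := Real.exp_pos (-c * t)
  have hY := norm_nonneg (y 0)
  calc _ ≤ Real.exp (-c * t) * (‖PhiF l‖ * ‖y 0‖) + C * ‖y 0‖ / (d - c) * Real.exp (-c * t)
        + (C + K) * W / d := by gcongr
    _ = (‖PhiF l‖ + C / (d - c)) * (Real.exp (-c * t) * ‖y 0‖) + (C + K) / d * W := by ring
    _ ≤ _ := by
      have p1 : 0 ≤ ‖PhiF l‖ + C / (d - c) := by positivity
      have p2 : 0 ≤ (C + K) / d := by positivity
      have p3 : 0 ≤ Real.exp (-c * t) * ‖y 0‖ := by positivity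
      nlinarith [mul_nonneg p1 hW, mul_nonneg p2 p3]

lemma EstF.gen {n m : ℕ} {A : Matrix (Fin n) (Fin n) ℝ} {B : Matrix (Fin n) (Fin m) ℝ}
    {c : ℝ} (hB : LinearMap.range B.mulVecLin ≤ LinearMap.range A.mulVecLin)
    (hc : 0 < c) {μ : ℂ} (hμ : c < -μ.re) (k : ℕ) : ∀ {l : Fin n → ℂ},
    ((FF A - μ • (1 : Module.End ℂ (Fin n → ℂ))) ^ k) l = 0 → EstF A B c l := by
  induction k with
  | zero =>
    intro l hl
    simp at hl
    exact EstF.zero_of_ker hB (by rw [hl, map_zero])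
  | succ k ih =>
    intro l hl
    apply EstF.step hc hμ
    apply ih
    rw [pow_succ] at hl
    simpa using hl

lemma EstF.all {n m : ℕ} {A : Matrix (Fin n) (Fin n) ℝ} {B : Matrix (Fin n) (Fin m) ℝ}
    (hA : IsSemiHurwitz A)
    (hB : LinearMap.range B.mulVecLin ≤ LinearMap.range A.mulVecLin) :
    ∃ c > (0:ℝ), ∀ l, EstF A B c l := by
  have hne : charpolyC A ≠ 0 := ((Matrix.charpoly_monic A).map _).ne_zero
  obtain ⟨c, hc, hcr⟩ : ∃ c > (0:ℝ), ∀ μ ∈ (charpolyC A).roots.toFinset, μ.re < 0 → c < -μ.re := by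
    generalize (charpolyC A).roots.toFinset = S
    induction S using Finset.induction_on with
    | empty => exact ⟨1, one_pos, by simp⟩
    | insert a s ha ih =>
      obtain ⟨c, hc, h⟩ := ih
      by_cases har : a.re < 0
      · refine ⟨min c (-a.re / 2), lt_min hc (by linarith), ?_⟩
        intro μ hμ hneg
        rcases Finset.mem_insert.1 hμ with rfl | hμ
        · exact (min_le_right _ _).trans_lt (by linarith)
        · exact (min_le_left _ _).trans_lt (h μ hμ hneg)
      · refine ⟨c, hc, ?_⟩
        intro μ hμ hneg
        rcases Finset.mem_insert.1 hμ with rfl | hμ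
        · exact absurd hneg har
        · exact h μ hμ hneg
  refine ⟨c, hc, fun l => ?_⟩
  have hchar : (FF A).charpoly = charpolyC A := by
    rw [FF, Matrix.charpoly_mulVecLin, Matrix.charpoly_map, Matrix.charpoly_transpose, charpolyC]
  have htop := Module.End.iSup_maxGenEigenspace_eq_top (FF A)
  have hl : l ∈ ⨆ μ, Module.End.maxGenEigenspace (FF A) μ := by rw [htop]; trivial
  refine Submodule.iSup_induction _ (motive := fun l => EstF A B c l) hl ?_
    (EstF.zero_of_ker hB (map_zero _)) (fun _ _ h h' => h.add h')
  intro μ v hv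
  by_cases hroot : (charpolyC A).IsRoot μ
  · obtain ⟨k, hk⟩ := (Module.End.mem_maxGenEigenspace _ _ _).1 hv
    rcases hA μ hroot with hneg | ⟨rfl, hd⟩
    · exact EstF.gen hB hc (hcr μ (by simp [hne]; exact hroot) hneg) k hk
    · apply EstF.zero_of_ker hB
      have := nondef A hd v k (by
        have h2 : FF A ^ k = ((Aᵀ.map (algebraMap ℝ ℂ)) ^ k).mulVecLin := by
          rw [FF]
          simp only [← Matrix.toLin'_apply', Matrix.toLin'_pow]
        rw [zero_smul, sub_zero, h2] at hk
        exact hk)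
      exact this
  · have h0 := LinearMap.finrank_maxGenEigenspace_eq (FF A) μ
    rw [hchar, Polynomial.rootMultiplicity_eq_zero hroot] at h0
    have := Submodule.finrank_eq_zero.1 h0
    rw [this] at hv
    rw [(Submodule.mem_bot ℂ).1 hv]
    exact EstF.zero_of_ker hB (map_zero _)

lemma integF {n m : ℕ} (A : Matrix (Fin n) (Fin n) ℝ) (B : Matrix (Fin n) (Fin m) ℝ)
    (w : ℝ → Fin m → ℝ) (hw : Measurable w)
    (hb : ∀ T > (0:ℝ), ∃ C : ℝ, ∀ᵐ s ∂(volume.restrict (Set.Icc (0:ℝ) T)), ‖w s‖ ≤ C)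
    (x₀ : Fin n → ℝ) (x : ℝ → Fin n → ℝ)
    (hx : ∀ t ≥ (0:ℝ), x t = x₀ + ∫ s in (0:ℝ)..t, (A.mulVec (x s) + B.mulVec (w s))) :
    ∀ t ≥ (0:ℝ), IntervalIntegrable (fun s => A *ᵥ (x s) + B *ᵥ (w s)) volume 0 t := by
  set f := (fun s => A *ᵥ (x s) + B *ᵥ (w s)) with hf
  by_contra! hcon
  obtain ⟨t0, ht0, hnot⟩ := hcon
  have hmono : ∀ {a b : ℝ}, 0 ≤ a → a ≤ b → IntervalIntegrable f volume 0 b →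
      IntervalIntegrable f volume 0 a := by
    intro a b ha hab h
    apply h.mono_set
    rw [Set.uIcc_of_le ha, Set.uIcc_of_le (ha.trans hab)]
    exact Set.Icc_subset_Icc le_rfl hab
  set S : Set ℝ := {t | 0 ≤ t ∧ IntervalIntegrable f volume 0 t} with hS
  have hS0 : (0:ℝ) ∈ S := ⟨le_rfl, IntervalIntegrable.refl⟩
  have hSb : BddAbove S := by
    refine ⟨t0, fun t ht => ?_⟩
    by_contra! h
    exact hnot (hmono ht0 h.le ht.2)
  set T := sSup S with hTdef
  have hT : 0 ≤ T := le_csSup hSb hS0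
  have hlt : ∀ t, 0 ≤ t → t < T → IntervalIntegrable f volume 0 t := by
    intro t h0 htT
    obtain ⟨s, hs, hts⟩ := exists_lt_of_lt_csSup ⟨0, hS0⟩ htT
    exact hmono h0 hts.le hs.2
  have hgt : ∀ t, T < t → ¬ IntervalIntegrable f volume 0 t := fun t ht h =>
    absurd (le_csSup hSb (show t ∈ S from ⟨hT.trans ht.le, h⟩)) (not_le.2 ht)
  have hxgt : ∀ t, T < t → x t = x₀ := by
    intro t ht
    rw [hx t (hT.trans ht.le), intervalIntegral.integral_undef (hgt t ht), add_zero]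
  obtain ⟨C, hC⟩ := hb (T + 1) (by linarith)
  rw [ae_restrict_iff' measurableSet_Icc] at hC
  set AL := LinearMap.toContinuousLinearMap A.mulVecLin
  set BL := LinearMap.toContinuousLinearMap B.mulVecLin
  have hAL : ∀ v, AL v = A *ᵥ v := fun v => rfl
  have hBL : ∀ v, BL v = B *ᵥ v := fun v => rfl
  have hBm : Measurable (fun s => B *ᵥ (w s)) := BL.continuous.measurable.comp hw
  set a := ‖AL‖
  set b := ‖BL‖ * max C 0
  have ha : 0 ≤ a := norm_nonneg _
  have hb0 : 0 ≤ b := by positivity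
  have hfb : ∀ᵐ s, s ∈ Set.Icc (0:ℝ) (T + 1) → ‖f s‖ ≤ a * ‖x s‖ + b := by
    filter_upwards [hC] with s hs hsT
    refine (norm_add_le _ _).trans (add_le_add (AL.le_opNorm _) ((BL.le_opNorm _).trans ?_))
    have := hs hsT
    have : ‖w s‖ ≤ max C 0 := this.trans (le_max_left _ _)
    simp only [b]
    gcongr
  have hcont : ∀ t1, 0 ≤ t1 → t1 < T → ContinuousOn x (Set.Icc 0 t1) := by
    intro t1 h0 h1
    have hi := hlt t1 h0 h1
    have : ContinuousOn (fun t => x₀ + ∫ s in (0:ℝ)..t, f s) (Set.Icc 0 t1) := by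
      have h2 := intervalIntegral.continuousOn_primitive_interval'
        (hi) (Set.left_mem_uIcc)
      rw [Set.uIcc_of_le h0] at h2
      exact continuousOn_const.add h2
    exact this.congr (fun t ht => hx t ht.1)
  -- step before `T`
  obtain ⟨δ, hδ, hδa⟩ : ∃ δ > (0:ℝ), δ * a ≤ 1 / 2 := by
    refine ⟨1 / (2 * (a + 1)), by positivity, ?_⟩
    rw [div_mul_eq_mul_div, div_le_div_iff₀ (by positivity) (by positivity)]
    linarith
  obtain ⟨t2, h02, h2T, hi2, h2δ⟩ : ∃ t2, 0 ≤ t2 ∧ t2 ≤ T ∧ IntervalIntegrable f volume 0 t2 ∧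
      T - t2 ≤ δ := by
    by_cases h : 0 < T
    · refine ⟨max 0 (T - δ), le_max_left _ _, max_le hT (by linarith), ?_, ?_⟩
      · exact hlt _ (le_max_left _ _) (max_lt h (by linarith))
      · have := le_max_right 0 (T - δ)
        linarith
    · exact ⟨0, le_rfl, hT, IntervalIntegrable.refl, by linarith⟩
  have hbd : ∀ t ∈ Set.Ico t2 T, ‖x t‖ ≤ 2 * (‖x t2‖ + δ * b) := by
    intro t ht
    have hc : ContinuousOn x (Set.Icc t2 t) :=
      (hcont t (h02.trans ht.1) ht.2).mono (Set.Icc_subset_Icc h02 le_rfl)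
    obtain ⟨p, hp, hmax⟩ := isCompact_Icc.exists_isMaxOn ⟨t, ht.1, le_rfl⟩ hc.norm
    have h0p := h02.trans hp.1
    have hxp : x p - x t2 = ∫ s in t2..p, f s := by
      rw [hx p h0p, hx t2 h02, add_sub_add_left_eq_sub]
      exact intervalIntegral.integral_interval_sub_left (hlt p h0p (hp.2.trans_lt ht.2)) hi2
    have hle : ‖x p - x t2‖ ≤ (a * ‖x p‖ + b) * |p - t2| := by
      rw [hxp]
      apply intervalIntegral.norm_integral_le_of_norm_le_const_ae
      filter_upwards [hfb] with s hs hs2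
      rw [Set.uIoc_of_le hp.1] at hs2
      have hst : s ∈ Set.Icc t2 t := ⟨hs2.1.le, hs2.2.trans hp.2⟩
      have h3 : ‖x s‖ ≤ ‖x p‖ := hmax hst
      refine (hs ⟨h02.trans hst.1, by linarith [hst.2, ht.2]⟩).trans ?_
      gcongr
    have hpd : |p - t2| ≤ δ := by
      rw [abs_of_nonneg (by linarith [hp.1])]
      linarith [hp.2, ht.2]
    have h5 : ‖x p‖ ≤ ‖x t2‖ + ‖x p - x t2‖ := by
      have := norm_add_le (x t2) (x p - x t2)
      simpa using this
    have h6 : (a * ‖x p‖ + b) * |p - t2| ≤ (a * ‖x p‖ + b) * δ := by gcongr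
    have h7 : ‖x t‖ ≤ ‖x p‖ := hmax (show t ∈ Set.Icc t2 t from ⟨ht.1, le_rfl⟩)
    have h8 : δ * a * ‖x p‖ ≤ 1 / 2 * ‖x p‖ := by gcongr
    nlinarith
  have hI1 : IntervalIntegrable f volume t2 T := by
    rw [intervalIntegrable_iff_integrableOn_Ioo_of_le h2T]
    refine IntegrableOn.of_bound (by simp) ?_ (a * (2 * (‖x t2‖ + δ * b)) + b) ?_
    · have hxc : ContinuousOn x (Set.Ioo t2 T) := by
        intro t ht
        have h3 := hcont ((t + T) / 2) (by linarith [ht.1, ht.2]) (by linarith [ht.2])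
        have : ContinuousAt x t :=
          h3.continuousAt (Icc_mem_nhds (by linarith [ht.1]) (by linarith [ht.2]))
        exact this.continuousWithinAt
      have h4 : ContinuousOn (fun s => A *ᵥ (x s)) (Set.Ioo t2 T) :=
        AL.continuous.comp_continuousOn hxc
      exact (h4.aestronglyMeasurable measurableSet_Ioo).add hBm.aestronglyMeasurable
    · rw [ae_restrict_iff' measurableSet_Ioo]
      filter_upwards [hfb] with s hs hs2
      refine (hs ⟨by linarith [hs2.1], by linarith [hs2.2]⟩).trans ?_
      have := hbd s ⟨hs2.1.le, hs2.2⟩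
      gcongr
  have hI2 : IntervalIntegrable f volume T (T + 1) := by
    rw [intervalIntegrable_iff_integrableOn_Ioc_of_le (by linarith)]
    refine IntegrableOn.of_bound (by simp) ?_ (a * ‖x₀‖ + b) ?_
    · have h4 : Measurable (fun s => A *ᵥ x₀ + B *ᵥ (w s)) := measurable_const.add hBm
      refine h4.aestronglyMeasurable.congr ?_
      rw [Filter.EventuallyEq, ae_restrict_iff' measurableSet_Ioc]
      filter_upwards with s hs
      simp only [hf, hxgt s hs.1]
    · rw [ae_restrict_iff' measurableSet_Ioc]
      filter_upwards [hfb] with s hs hs2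
      have := hs ⟨by linarith [hs2.1], hs2.2⟩
      rwa [hxgt s hs2.1] at this
  exact hgt (T + 1) (by linarith) ((hi2.trans hI1).trans hI2)

/-- ISS-type estimate for the continuous-time LTI system `ẋ = Ax + Bw` with a semi-Hurwitz
matrix `A` and `ran(B) ⊆ ran(A)`: the solution converges, up to the oblique projection `x*`
of `x₀` onto `ker A` along `ran A`, exponentially with an input gain on the essential
supremum of `‖w‖`. The constants are independent of `x₀` and `w`. -/
theorem semiHurwitz_LTI_ISS {n m : ℕ} (A : Matrix (Fin n) (Fin n) ℝ)
    (B : Matrix (Fin n) (Fin m) ℝ)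
    (hA : IsSemiHurwitz A)
    (hB : LinearMap.range B.mulVecLin ≤ LinearMap.range A.mulVecLin) :
    ∃ c₁ > (0:ℝ), ∃ c₂ > (0:ℝ), ∃ c₃ > (0:ℝ),
      ∀ (w : ℝ → Fin m → ℝ), Measurable w →
        (∀ T > (0:ℝ), ∃ C : ℝ, ∀ᵐ s ∂(volume.restrict (Set.Icc (0:ℝ) T)), ‖w s‖ ≤ C) →
        ∀ (x₀ : Fin n → ℝ) (x : ℝ → Fin n → ℝ),
          (∀ t ≥ (0:ℝ), x t = x₀ + ∫ s in (0:ℝ)..t, (A.mulVec (x s) + B.mulVec (w s))) →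
          ∀ xstar : Fin n → ℝ,
            xstar ∈ LinearMap.ker A.mulVecLin →
            x₀ - xstar ∈ LinearMap.range A.mulVecLin →
            ∀ t ≥ (0:ℝ),
              ‖x t - xstar‖ ≤ c₁ * Real.exp (-c₂ * t) * ‖x₀ - xstar‖ +
                c₃ * essSup (fun s => ‖w s‖) (volume.restrict (Set.Icc (0:ℝ) t)) := by
  obtain ⟨c, hc, hest⟩ := EstF.all hA hB
  choose C hC0 hC using fun i : Fin n => hest (Pi.single i 1)
  have hCs : ∀ i, C i ≤ (∑ j, C j) + 1 := fun i => by
    have := Finset.single_le_sum (f := C) (fun j _ => hC0 j) (Finset.mem_univ i)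
    linarith
  have hCp : 0 < (∑ j, C j) + 1 := by
    have := Finset.sum_nonneg (s := Finset.univ) (f := C) (fun j _ => hC0 j)
    linarith
  refine ⟨_, hCp, c, hc, _, hCp, ?_⟩
  intro w hw hb x₀ x hx xstar hker hran t ht
  set D := (∑ j, C j) + 1
  set W := essSup (fun s => ‖w s‖) (volume.restrict (Set.Icc (0:ℝ) t)) with hWdef
  have hAs : A *ᵥ xstar = 0 := hker
  have hfint := integF A B w hw hb x₀ x hx
  have hx0 : x 0 = x₀ := by simpa using hx 0 le_rfl
  have hWW : 0 ≤ W ∧ ∀ᵐ s, s ∈ Set.Icc (0:ℝ) t → ‖w s‖ ≤ W := by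
    rcases ht.eq_or_lt' with h0 | hpos
    · subst h0
      have hz : volume.restrict (Set.Icc (0:ℝ) 0) = 0 := by simp
      constructor
      · rw [hWdef, hz]
        simp [essSup, Filter.limsup, Filter.limsSup]
      · have : ∀ᵐ s : ℝ, s ≠ 0 := Measure.ae_ne volume 0
        filter_upwards [this] with s hs hs2
        exact absurd (le_antisymm hs2.2 hs2.1) hs
    · obtain ⟨K, hK⟩ := hb t hpos
      have hle : ∀ᵐ s ∂(volume.restrict (Set.Icc (0:ℝ) t)), ‖w s‖ ≤ W :=
        ae_le_essSup ⟨K, by simpa using hK⟩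
      refine ⟨?_, (ae_restrict_iff' measurableSet_Icc).1 hle⟩
      have : (ae (volume.restrict (Set.Icc (0:ℝ) t))).NeBot := by
        rw [ae_neBot, Ne, Measure.restrict_eq_zero]
        simp [hpos]
      obtain ⟨s, hs⟩ := hle.exists
      exact (norm_nonneg _).trans hs
  have hAc : Continuous (fun v : Fin n → ℝ => A *ᵥ v) :=
    (LinearMap.toContinuousLinearMap A.mulVecLin).continuous
  have hxc : ContinuousOn x (Set.Icc 0 t) := by
    have h2 := intervalIntegral.continuousOn_primitive_interval' (hfint t ht) Set.left_mem_uIcc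
    rw [Set.uIcc_of_le ht] at h2
    exact (continuousOn_const.add h2).congr (fun s hs => hx s hs.1)
  have hsol : SolD A B (fun s => x s - xstar) w t W := by
    refine ⟨ht, hWW.1, hxc.sub continuousOn_const, ?_, hWW.2, ?_, ?_⟩
    · have h1 : IntervalIntegrable (fun s => A *ᵥ x s) volume 0 t :=
        ContinuousOn.intervalIntegrable (by
          rw [Set.uIcc_of_le ht]; exact hAc.comp_continuousOn hxc)
      have := (hfint t ht).sub h1
      refine this.congr ?_
      intro s _
      simp
    · intro s hs
      simp only [Matrix.mulVec_sub, hAs, sub_zero]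
      rw [hx s hs.1, hx0]
      abel
    · simpa only [hx0] using hran
  have hn := norm_nonneg (x₀ - xstar)
  have hW0 := hWW.1
  have hrw : D * Real.exp (-c * t) * ‖x₀ - xstar‖ + D * W =
      D * (Real.exp (-c * t) * ‖x₀ - xstar‖ + W) := by ring
  rw [hrw, pi_norm_le_iff_of_nonneg (by positivity)]
  intro i
  have h1 := hC i _ w t W hsol t ⟨ht, le_rfl⟩
  have h2 : PhiF (Pi.single i 1) (x t - xstar) = (((x t - xstar) i : ℝ) : ℂ) := by
    rw [PhiF_apply, Finset.sum_eq_single i]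
    · simp
    · intro j _ hj; simp [hj]
    · simp
  simp only [hx0] at h1
  rw [h2, Complex.norm_real] at h1
  exact h1.trans (by gcongr; exact hCs i)
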